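/- Lambert's theorem in the hyperbolic plane: in an equilateral hyperbolic triangle, the medians meet at a point O with tanh AO / tanh OD = 2 for each median AD (D the midpoint of the opposite side); consequently AD/OD > 3. -/

import Mathlib

open Real UpperHalfPlane

/-- `Y` lies strictly between `X` and `Z` on the geodesic segment `XZ`. -/
def HypBtw (X Y Z : UpperHalfPlane) : Prop :=
  Y ≠ X ∧ Y ≠ Z ∧ dist X Y + dist Y Z = dist X Z

/-- `M` is the midpoint of the geodesic segment `XZ`. -/
def HypMidpoint (X M Z : UpperHalfPlane) : Prop :=
  dist X M = dist M Z ∧ dist X M + dist M Z = dist X Z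

/-- A positive combination of two points of the hyperboloid model is, up to scaling, again a point
of it; here the Lorentz form is expressed through `cosh` of the distance. -/
lemma exists_cosh_dist_combination (X Y : UpperHalfPlane) {a b : ℝ} (ha : 0 < a) (hb : 0 < b) :
    ∃ P : UpperHalfPlane, ∃ N : ℝ, 0 < N ∧ ∀ Z : UpperHalfPlane,
      N * Real.cosh (dist P Z) = a * Real.cosh (dist X Z) + b * Real.cosh (dist Y Z) := by
  have hX : 0 < X.im := X.im_pos
  have hY : 0 < Y.im := Y.im_pos
  obtain ⟨p, hp⟩ : ∃ p, p = a / X.im + b / Y.im := ⟨_, rfl⟩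
  obtain ⟨q, hq⟩ : ∃ q, q = a * X.re / X.im + b * Y.re / Y.im := ⟨_, rfl⟩
  obtain ⟨r, hr⟩ : ∃ r, r = a * (X.re ^ 2 + X.im ^ 2) / X.im + b * (Y.re ^ 2 + Y.im ^ 2) / Y.im :=
    ⟨_, rfl⟩
  have hp0 : 0 < p := by rw [hp]; positivity
  have hdisc : 0 < p * r - q ^ 2 := by
    have h : p * r - q ^ 2 = a ^ 2 + b ^ 2 +
        a * b * ((X.re - Y.re) ^ 2 + X.im ^ 2 + Y.im ^ 2) / (X.im * Y.im) := by
      rw [hp, hq, hr]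
      field_simp
      ring
    rw [h]
    positivity
  obtain ⟨s, hs⟩ : ∃ s, s = √(p * r - q ^ 2) := ⟨_, rfl⟩
  have hs0 : 0 < s := hs ▸ Real.sqrt_pos.2 hdisc
  have hs2 : s ^ 2 = p * r - q ^ 2 := hs ▸ Real.sq_sqrt hdisc.le
  refine ⟨UpperHalfPlane.mk ⟨q / p, s / p⟩ (div_pos hs0 hp0), s, hs0, fun Z => ?_⟩
  have hZ : 0 < Z.im := Z.im_pos
  have key : s * Real.cosh (dist (UpperHalfPlane.mk ⟨q / p, s / p⟩ (div_pos hs0 hp0)) Z) =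
      (r - 2 * q * Z.re + p * (Z.re ^ 2 + Z.im ^ 2)) / (2 * Z.im) := by
    rw [UpperHalfPlane.cosh_dist']
    change s * (((q / p - Z.re) ^ 2 + (s / p) ^ 2 + Z.im ^ 2) / (2 * (s / p) * Z.im)) = _
    field_simp
    rw [hs2]
    ring
  rw [key, UpperHalfPlane.cosh_dist', UpperHalfPlane.cosh_dist', hp, hq, hr]
  field_simp
  ring

/-- The median formula of the hyperbolic plane. -/
lemma HypMidpoint.cosh_dist_add_cosh_dist {X M Y : UpperHalfPlane} (h : HypMidpoint X M Y)
    (Z : UpperHalfPlane) :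
    2 * Real.cosh (dist X M) * Real.cosh (dist M Z) =
      Real.cosh (dist X Z) + Real.cosh (dist Y Z) := by
  obtain ⟨h₁, h₂⟩ := h
  obtain ⟨P, N, hN, hP⟩ := exists_cosh_dist_combination X Y one_pos one_pos
  simp only [one_mul] at hP
  have hXY : Real.cosh (dist X Y) = 2 * Real.cosh (dist X M) ^ 2 - 1 := by
    rw [← h₂, ← h₁, ← two_mul, Real.cosh_two_mul, Real.sinh_sq]
    ring
  have hm : 0 < Real.cosh (dist X M) := Real.cosh_pos _
  have hPX := hP X
  have hPY := hP Y
  have hPP := hP P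
  have hPM := hP M
  rw [dist_self, Real.cosh_zero, dist_comm Y X, hXY] at hPX
  rw [dist_self, Real.cosh_zero, hXY] at hPY
  rw [dist_self, Real.cosh_zero, dist_comm X P, dist_comm Y P] at hPP
  rw [dist_comm Y M, ← h₁] at hPM
  have hNm : N = 2 * Real.cosh (dist X M) := by
    have : N ^ 2 = (2 * Real.cosh (dist X M)) ^ 2 := by
      linear_combination N * hPP + hPX + hPY
    exact (pow_left_inj₀ hN.le (by positivity) two_ne_zero).1 this
  have hcosh : Real.cosh (dist P M) = 1 := by
    apply mul_left_cancel₀ hN.ne'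
    linear_combination hPM - hNm
  have hPM_eq : P = M := by
    by_contra hne
    exact (Real.one_lt_cosh.2 (dist_pos.2 hne).ne').ne' hcosh
  rw [← hNm, ← hP Z, hPM_eq]

/-- The metric relations along one median of an equilateral hyperbolic triangle, where `m` is `cosh`
of half the side. -/
lemma hypBtw_and_tanh_eq_of_cosh_dist {A O D : UpperHalfPlane} {m : ℝ} (hm : 1 < m)
    (hAO : 3 * Real.cosh (dist A O) ^ 2 = 4 * m ^ 2 - 1)
    (hOD : m * Real.cosh (dist O D) = Real.cosh (dist A O))
    (hAD : m * Real.cosh (dist A D) = 2 * m ^ 2 - 1) :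
    HypBtw A O D ∧ Real.tanh (dist A O) = 2 * Real.tanh (dist O D) ∧
      dist A D > 3 * dist O D := by
  have hm0 : 0 < m := by linarith
  have hn := Real.cosh_pos (dist A O)
  have hk := Real.cosh_pos (dist O D)
  have hs : 0 ≤ Real.sinh (dist A O) := Real.sinh_nonneg_iff.2 dist_nonneg
  have ht : 0 ≤ Real.sinh (dist O D) := Real.sinh_nonneg_iff.2 dist_nonneg
  have hs2 := Real.sinh_sq (dist A O)
  have ht2 := Real.sinh_sq (dist O D)
  have hst : Real.sinh (dist A O) = 2 * m * Real.sinh (dist O D) := by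
    refine (pow_left_inj₀ hs (by positivity) two_ne_zero).1 ?_
    rw [mul_pow, hs2, ht2]
    linear_combination - hAO - 4 * (m * Real.cosh (dist O D) + Real.cosh (dist A O)) * hOD
  have ht3 : 3 * m ^ 2 * Real.sinh (dist O D) ^ 2 = m ^ 2 - 1 := by
    rw [ht2]
    linear_combination hAO + 3 * (m * Real.cosh (dist O D) + Real.cosh (dist A O)) * hOD
  have ht0 : 0 < Real.sinh (dist O D) := by
    refine ht.lt_of_ne fun h => ?_
    rw [← h] at ht3
    nlinarith
  have hs0 : 0 < Real.sinh (dist A O) := by rw [hst]; positivity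
  have hx : 0 < dist O D := Real.sinh_pos_iff.1 ht0
  have hy : 0 < dist A O := Real.sinh_pos_iff.1 hs0
  have hadd : dist A O + dist O D = dist A D := by
    have hcosh : Real.cosh (dist A O + dist O D) = Real.cosh (dist A D) := by
      apply mul_left_cancel₀ hm0.ne'
      rw [Real.cosh_add, hst, hAD]
      linear_combination Real.cosh (dist A O) * hOD + hAO / 3 + 2 / 3 * ht3
    exact Real.cosh_strictMonoOn.injOn (Set.mem_Ici.2 (by positivity))
      (Set.mem_Ici.2 dist_nonneg) hcosh
  refine ⟨⟨(dist_pos.1 hy).symm, dist_pos.1 hx, hadd⟩, ?_, ?_⟩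
  · rw [Real.tanh_eq_sinh_div_cosh, Real.tanh_eq_sinh_div_cosh, hst, ← hOD]
    field_simp
  · have hlt : Real.sinh (dist O D) < Real.sinh (dist A O - dist O D) := by
      rw [Real.sinh_sub, hst]
      have h1 : 1 < Real.cosh (dist A O) := Real.one_lt_cosh.2 hy.ne'
      have h2 : 2 * m * Real.sinh (dist O D) * Real.cosh (dist O D) -
          Real.cosh (dist A O) * Real.sinh (dist O D) =
          Real.cosh (dist A O) * Real.sinh (dist O D) := by
        linear_combination 2 * Real.sinh (dist O D) * hOD
      rw [h2]
      exact lt_mul_of_one_lt_left ht0 h1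
    have := Real.sinh_lt_sinh.1 hlt
    linarith

/-- One median `AD` of an equilateral triangle, with `O` the normalized sum of the vertices. -/
lemma hypBtw_and_tanh_eq_of_midpoint {A B C D O : UpperHalfPlane} {N : ℝ} (hN : 0 < N)
    (hBC : B ≠ C) (hAB : dist A B = dist B C) (hCA : dist C A = dist B C)
    (hD : HypMidpoint B D C)
    (hO : ∀ Z, N * Real.cosh (dist O Z) =
      Real.cosh (dist A Z) + Real.cosh (dist B Z) + Real.cosh (dist C Z)) :
    HypBtw A O D ∧ Real.tanh (dist A O) = 2 * Real.tanh (dist O D) ∧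
      dist A D > 3 * dist O D := by
  have hmed := hD.cosh_dist_add_cosh_dist
  obtain ⟨h₁, h₂⟩ := hD
  have ha : 0 < dist B C := dist_pos.2 hBC
  have hBD : dist B D ≠ 0 := by intro h; linarith
  have hm := Real.one_lt_cosh.2 hBD
  have hc : Real.cosh (dist B C) = 2 * Real.cosh (dist B D) ^ 2 - 1 := by
    rw [← h₂, ← h₁, ← two_mul, Real.cosh_two_mul, Real.sinh_sq]
    ring
  have hOA := hO A
  have hOB := hO B
  have hOC := hO C
  have hOO := hO O
  have hmA := hmed A
  have hmO := hmed O
  rw [dist_self, Real.cosh_zero, dist_comm B A, hAB, hCA, hc, dist_comm O A] at hOA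
  rw [dist_self, Real.cosh_zero, hAB, dist_comm C B, hc, dist_comm O B] at hOB
  rw [dist_self, Real.cosh_zero, dist_comm A C, hCA, hc, dist_comm O C] at hOC
  rw [dist_self, Real.cosh_zero] at hOO
  rw [dist_comm B A, hAB, hCA, hc, dist_comm D A] at hmA
  rw [dist_comm D O] at hmO
  have hBA : Real.cosh (dist B O) = Real.cosh (dist A O) :=
    mul_left_cancel₀ hN.ne' (by linarith)
  have hCA' : Real.cosh (dist C O) = Real.cosh (dist A O) :=
    mul_left_cancel₀ hN.ne' (by linarith)
  rw [hBA, hCA'] at hOO hmO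
  refine hypBtw_and_tanh_eq_of_cosh_dist hm ?_ (by linarith) (by linarith)
  linear_combination hOA - Real.cosh (dist A O) * hOO

/-- Lambert's theorem: in an equilateral hyperbolic triangle the medians meet at a
point `O` with `tanh AO = 2 tanh OD` for each median, and consequently `AD > 3 OD`. -/
theorem lambert_equilateral_hyperbolic (A B C D E F : UpperHalfPlane)
    (hAB : A ≠ B) (hBC : B ≠ C) (hCA : C ≠ A)
    (hnd : dist A B < dist A C + dist C B)
    (heq : dist A B = dist B C ∧ dist B C = dist C A)
    (hD : HypMidpoint B D C) (hE : HypMidpoint C E A) (hF : HypMidpoint A F B) :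
    ∃ O : UpperHalfPlane,
      HypBtw A O D ∧ HypBtw B O E ∧ HypBtw C O F ∧
      Real.tanh (dist A O) = 2 * Real.tanh (dist O D) ∧
      Real.tanh (dist B O) = 2 * Real.tanh (dist O E) ∧
      Real.tanh (dist C O) = 2 * Real.tanh (dist O F) ∧
      dist A D > 3 * dist O D := by
  obtain ⟨hab, hbc⟩ := heq
  obtain ⟨P, K, hK, hP⟩ := exists_cosh_dist_combination A B one_pos one_pos
  obtain ⟨O, N, hN, hO⟩ := exists_cosh_dist_combination P C hK one_pos
  have hsum : ∀ Z, N * Real.cosh (dist O Z) =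
      Real.cosh (dist A Z) + Real.cosh (dist B Z) + Real.cosh (dist C Z) := fun Z => by
    rw [hO, hP]
    ring
  obtain ⟨hA₁, hA₂, hA₃⟩ := hypBtw_and_tanh_eq_of_midpoint hN hBC hab hbc.symm hD hsum
  obtain ⟨hB₁, hB₂, -⟩ := hypBtw_and_tanh_eq_of_midpoint hN hCA hbc (hab.trans hbc) hE
    fun Z => (hsum Z).trans (by ring)
  obtain ⟨hC₁, hC₂, -⟩ := hypBtw_and_tanh_eq_of_midpoint hN hAB (hab.trans hbc).symm hab.symm hF
    fun Z => (hsum Z).trans (by ring)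
  exact ⟨O, hA₁, hB₁, hC₁, hA₂, hB₂, hC₂, hA₃⟩
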